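/- Let G = (V, E) be a graph on n vertices with weights w_e ≥ 0, and let H = Σ_{ij∈E} w_ij(I − X_iX_j − Y_iY_j − Z_iZ_j) ∈ ℂ^{2^n×2^n} be the Quantum Max Cut Hamiltonian. For every unit vector ψ ∈ ℂ^{2^n} there exists a Lasserre₁-feasible matrix M whose Lasserre₁ objective equals ⟨ψ, Hψ⟩. Consequently, the largest eigenvalue of H is at most the supremum of the Lasserre₁ objective over all Lasserre₁-feasible matrices. -/

import Mathlib

open Matrix

/-- The 2×2 Pauli X matrix. -/
noncomputable def pauliX : Matrix (Fin 2) (Fin 2) ℂ := !![0, 1; 1, 0]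

/-- The 2×2 Pauli Y matrix. -/
noncomputable def pauliY : Matrix (Fin 2) (Fin 2) ℂ := !![0, -Complex.I; Complex.I, 0]

/-- The 2×2 Pauli Z matrix. -/
noncomputable def pauliZ : Matrix (Fin 2) (Fin 2) ℂ := !![1, 0; 0, -1]

/-- The operator `σ_i σ_j` on `m` qubits: the Kronecker product with the 2×2 matrix `σ`
at positions `i` and `j` and the 2×2 identity elsewhere, realized on `ℂ^{2^m}`
identified with functions `Fin m → Fin 2`. -/
noncomputable def twoLocal {m : ℕ} (σ : Matrix (Fin 2) (Fin 2) ℂ) (i j : Fin m) :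
    Matrix (Fin m → Fin 2) (Fin m → Fin 2) ℂ :=
  Matrix.of fun f g => ∏ k, (if k = i ∨ k = j then σ else 1) (f k) (g k)

/-- Row/column index set for the level-1 Lasserre moment matrix on `n` vertices. -/
abbrev L1Idx (n : ℕ) := (Fin 3 × Fin n) ⊕ Unit

/-- A real symmetric matrix `M`, with rows and columns indexed by
`{σ_i : σ ∈ {X,Y,Z}, i a vertex} ∪ {I}`, is Lasserre₁-feasible if it is positive
semidefinite, has all diagonal entries equal to `1`, and satisfies
`M(σ_i, η_i) = 0` for all distinct `σ, η ∈ {X,Y,Z}` and every vertex `i`. -/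
def Lasserre1Feasible {n : ℕ} (M : Matrix (L1Idx n) (L1Idx n) ℝ) : Prop :=
  M.IsSymm ∧ M.PosSemidef ∧ (∀ a, M a a = 1) ∧
    (∀ (i : Fin n) (σ η : Fin 3), σ ≠ η → M (.inl (σ, i)) (.inl (η, i)) = 0)

/-- The Lasserre₁ objective for the weighted graph with edge list `E` and weights `w`:
`Σ_{ij∈E} w_ij (1 − M(X_i,X_j) − M(Y_i,Y_j) − M(Z_i,Z_j))`. -/
def lasserre1Obj {n : ℕ} (E : Finset (Fin n × Fin n)) (w : Fin n × Fin n → ℝ)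
    (M : Matrix (L1Idx n) (L1Idx n) ℝ) : ℝ :=
  ∑ p ∈ E, w p * (1 - M (.inl (0, p.1)) (.inl (0, p.2))
    - M (.inl (1, p.1)) (.inl (1, p.2)) - M (.inl (2, p.1)) (.inl (2, p.2)))

/-- The Kronecker product of a family of 2×2 matrices, on functions `Fin n → Fin 2`. -/
noncomputable def piKronecker {n : ℕ} (A : Fin n → Matrix (Fin 2) (Fin 2) ℂ) :
    Matrix (Fin n → Fin 2) (Fin n → Fin 2) ℂ :=
  Matrix.of fun f g => ∏ k, A k (f k) (g k)

lemma piKronecker_mul {n : ℕ} (A B : Fin n → Matrix (Fin 2) (Fin 2) ℂ) :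
    piKronecker A * piKronecker B = piKronecker (A * B) := by
  ext f g
  simp only [piKronecker, Matrix.mul_apply, Matrix.of_apply, Pi.mul_apply,
    ← Finset.prod_mul_distrib]
  exact (Fintype.prod_sum fun k x => A k (f k) x * B k x (g k)).symm

lemma piKronecker_one {n : ℕ} :
    piKronecker (1 : Fin n → Matrix (Fin 2) (Fin 2) ℂ) = 1 := by
  ext f g
  simp only [piKronecker, Matrix.of_apply, Pi.one_apply, Matrix.one_apply]
  rw [Finset.prod_ite_zero]
  simp [funext_iff]

lemma piKronecker_isHermitian {n : ℕ} {A : Fin n → Matrix (Fin 2) (Fin 2) ℂ}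
    (hA : ∀ k, (A k).IsHermitian) : (piKronecker A).IsHermitian := by
  ext f g
  simp only [piKronecker, Matrix.conjTranspose_apply, Matrix.of_apply, star_prod]
  exact Finset.prod_congr rfl fun k _ => (hA k).apply _ _

/-- The operator acting as `σ` on the qubit `i` and as the identity elsewhere. -/
noncomputable def oneLocal {n : ℕ} (σ : Matrix (Fin 2) (Fin 2) ℂ) (i : Fin n) :
    Matrix (Fin n → Fin 2) (Fin n → Fin 2) ℂ :=
  piKronecker (Pi.mulSingle i σ)

lemma oneLocal_isHermitian {n : ℕ} {σ : Matrix (Fin 2) (Fin 2) ℂ} (hσ : σ.IsHermitian)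
    (i : Fin n) : (oneLocal σ i).IsHermitian := by
  refine piKronecker_isHermitian fun k => ?_
  by_cases hk : k = i
  · subst hk
    simpa using hσ
  · simp [hk, Matrix.isHermitian_one]

lemma oneLocal_mul {n : ℕ} (σ η : Matrix (Fin 2) (Fin 2) ℂ) (i : Fin n) :
    oneLocal σ i * oneLocal η i = oneLocal (σ * η) i := by
  rw [oneLocal, oneLocal, piKronecker_mul, ← Pi.mulSingle_mul, oneLocal]

lemma oneLocal_one {n : ℕ} (i : Fin n) : oneLocal 1 i = 1 := by
  rw [oneLocal, Pi.mulSingle_one, piKronecker_one]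

lemma oneLocal_neg {n : ℕ} (σ : Matrix (Fin 2) (Fin 2) ℂ) (i : Fin n) :
    oneLocal (-σ) i = -oneLocal σ i := by
  ext f g
  simp only [oneLocal, piKronecker, Matrix.of_apply, Matrix.neg_apply]
  rw [← Finset.mul_prod_erase _ _ (Finset.mem_univ i),
    ← Finset.mul_prod_erase Finset.univ
      (fun k => (Pi.mulSingle i σ : Fin n → Matrix (Fin 2) (Fin 2) ℂ) k (f k) (g k))
      (Finset.mem_univ i)]
  simp only [Pi.mulSingle_eq_same, Matrix.neg_apply, neg_mul, neg_inj]
  congr 1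
  refine Finset.prod_congr rfl fun k hk => ?_
  simp [Finset.ne_of_mem_erase hk]

lemma oneLocal_mul_of_ne {n : ℕ} (σ : Matrix (Fin 2) (Fin 2) ℂ) {i j : Fin n} (hij : i ≠ j) :
    oneLocal σ i * oneLocal σ j = twoLocal σ i j := by
  rw [oneLocal, oneLocal, piKronecker_mul]
  ext f g
  simp only [piKronecker, twoLocal, Matrix.of_apply]
  refine Finset.prod_congr rfl fun k _ => ?_
  by_cases hi : k = i
  · subst hi
    simp [hij]
  · by_cases hj : k = j
    · subst hj
      simp [hi]
    · simp [hi, hj]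

/-- The three Pauli matrices, indexed by `Fin 3`. -/
noncomputable def pauli : Fin 3 → Matrix (Fin 2) (Fin 2) ℂ := ![pauliX, pauliY, pauliZ]

lemma pauli_isHermitian (σ : Fin 3) : (pauli σ).IsHermitian := by
  ext a b
  fin_cases σ <;> fin_cases a <;> fin_cases b <;> simp [pauli, pauliX, pauliY, pauliZ]

lemma pauli_mul_self (σ : Fin 3) : pauli σ * pauli σ = 1 := by
  ext a b
  fin_cases σ <;> fin_cases a <;> fin_cases b <;>
    simp [pauli, pauliX, pauliY, pauliZ, Matrix.mul_apply]

lemma pauli_anticomm {σ η : Fin 3} (h : σ ≠ η) : pauli σ * pauli η = -(pauli η * pauli σ) := by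
  ext a b
  fin_cases σ <;> fin_cases η <;> first
    | exact absurd rfl h
    | fin_cases a <;> fin_cases b <;> simp [pauli, pauliX, pauliY, pauliZ, Matrix.mul_apply]

/-- The operator labelled by an index of the level-1 Lasserre moment matrix. -/
noncomputable def l1Operator {n : ℕ} : L1Idx n → Matrix (Fin n → Fin 2) (Fin n → Fin 2) ℂ
  | .inl (σ, i) => oneLocal (pauli σ) i
  | .inr _ => 1

lemma l1Operator_isHermitian {n : ℕ} (a : L1Idx n) : (l1Operator a).IsHermitian := by
  rcases a with ⟨σ, i⟩ | _
  · exact oneLocal_isHermitian (pauli_isHermitian σ) i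
  · exact Matrix.isHermitian_one

lemma l1Operator_mul_self {n : ℕ} (a : L1Idx n) : l1Operator a * l1Operator a = 1 := by
  rcases a with ⟨σ, i⟩ | _
  · rw [l1Operator, oneLocal_mul, pauli_mul_self, oneLocal_one]
  · exact one_mul 1

lemma l1Operator_anticomm {n : ℕ} (i : Fin n) {σ η : Fin 3} (h : σ ≠ η) :
    l1Operator (.inl (σ, i)) * l1Operator (.inl (η, i)) =
      -(l1Operator (.inl (η, i)) * l1Operator (.inl (σ, i))) := by
  simp only [l1Operator]
  rw [oneLocal_mul, oneLocal_mul, pauli_anticomm h, oneLocal_neg]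

/-- The moment matrix `M(Γ, Φ) = Re ⟨ψ, ΓΦψ⟩` of a state `ψ`. -/
noncomputable def momentMatrix {n : ℕ} (ψ : (Fin n → Fin 2) → ℂ) :
    Matrix (L1Idx n) (L1Idx n) ℝ :=
  Matrix.of fun a b => (star ψ ⬝ᵥ (l1Operator a * l1Operator b) *ᵥ ψ).re

lemma star_dotProduct_mulVec {ι : Type*} [Fintype ι] (A : Matrix ι ι ℂ) (ψ : ι → ℂ) :
    star (star ψ ⬝ᵥ A *ᵥ ψ) = star ψ ⬝ᵥ Aᴴ *ᵥ ψ := by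
  rw [← Matrix.star_dotProduct, Matrix.star_mulVec, Matrix.dotProduct_mulVec]

lemma star_l1Operator_mul {n : ℕ} (ψ : (Fin n → Fin 2) → ℂ) (a b : L1Idx n) :
    star (star ψ ⬝ᵥ (l1Operator a * l1Operator b) *ᵥ ψ) =
      star ψ ⬝ᵥ (l1Operator b * l1Operator a) *ᵥ ψ := by
  rw [star_dotProduct_mulVec, Matrix.conjTranspose_mul, (l1Operator_isHermitian a).eq,
    (l1Operator_isHermitian b).eq]

lemma momentMatrix_comm {n : ℕ} (ψ : (Fin n → Fin 2) → ℂ) (a b : L1Idx n) :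
    momentMatrix ψ a b = momentMatrix ψ b a := by
  simp [momentMatrix, ← star_l1Operator_mul ψ a b]

lemma momentMatrix_posSemidef {n : ℕ} (ψ : (Fin n → Fin 2) → ℂ) :
    (momentMatrix ψ).PosSemidef := by
  set R : Matrix (Fin n → Fin 2) (L1Idx n) ℝ := Matrix.of fun f a => ((l1Operator a *ᵥ ψ) f).re
  set S : Matrix (Fin n → Fin 2) (L1Idx n) ℝ := Matrix.of fun f a => ((l1Operator a *ᵥ ψ) f).im
  have h : momentMatrix ψ = Rᴴ * R + Sᴴ * S := by
    ext a b
    have hab : star ψ ⬝ᵥ (l1Operator a * l1Operator b) *ᵥ ψ =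
        star (l1Operator a *ᵥ ψ) ⬝ᵥ (l1Operator b *ᵥ ψ) := by
      rw [Matrix.star_mulVec, (l1Operator_isHermitian a).eq, ← Matrix.mulVec_mulVec,
        Matrix.dotProduct_mulVec]
    rw [momentMatrix, Matrix.of_apply, hab]
    simp [R, S, Matrix.mul_apply, dotProduct, Finset.sum_add_distrib]
  rw [h]
  exact (Matrix.posSemidef_conjTranspose_mul_self R).add
    (Matrix.posSemidef_conjTranspose_mul_self S)

lemma star_dotProduct_self_eq_one {ι : Type*} [Fintype ι] {ψ : ι → ℂ}
    (hψ : ∑ f, Complex.normSq (ψ f) = 1) : star ψ ⬝ᵥ ψ = 1 := by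
  simp only [dotProduct, Pi.star_apply, Complex.star_def, ← Complex.normSq_eq_conj_mul_self]
  exact_mod_cast hψ

lemma momentMatrix_feasible {n : ℕ} {ψ : (Fin n → Fin 2) → ℂ}
    (hψ : ∑ f, Complex.normSq (ψ f) = 1) : Lasserre1Feasible (momentMatrix ψ) := by
  refine ⟨Matrix.IsSymm.ext fun a b => momentMatrix_comm ψ b a, momentMatrix_posSemidef ψ,
    fun a => ?_, fun i σ η h => ?_⟩
  · simp [momentMatrix, l1Operator_mul_self, star_dotProduct_self_eq_one hψ]
  · have hneg : momentMatrix ψ (.inl (σ, i)) (.inl (η, i)) =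
        -momentMatrix ψ (.inl (η, i)) (.inl (σ, i)) := by
      simp [momentMatrix, l1Operator_anticomm i h, Matrix.neg_mulVec]
    have hsymm := momentMatrix_comm ψ (.inl (σ, i)) (.inl (η, i))
    linarith

lemma twoLocal_comm {n : ℕ} (σ : Matrix (Fin 2) (Fin 2) ℂ) (i j : Fin n) :
    twoLocal σ i j = twoLocal σ j i := by
  simp only [twoLocal, or_comm]

lemma momentMatrix_eq_twoLocal {n : ℕ} (ψ : (Fin n → Fin 2) → ℂ) (σ : Fin 3) {i j : Fin n}
    (hij : i ≠ j) :
    (momentMatrix ψ (.inl (σ, i)) (.inl (σ, j)) : ℂ) =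
      star ψ ⬝ᵥ twoLocal (pauli σ) i j *ᵥ ψ := by
  have h := star_l1Operator_mul ψ (.inl (σ, i)) (.inl (σ, j))
  simp only [l1Operator, oneLocal_mul_of_ne _ hij, oneLocal_mul_of_ne _ hij.symm,
    twoLocal_comm _ j i] at h
  simp only [momentMatrix, l1Operator, Matrix.of_apply, oneLocal_mul_of_ne _ hij]
  exact Complex.conj_eq_iff_re.mp h

lemma lasserre1Obj_momentMatrix {n : ℕ} (E : Finset (Fin n × Fin n))
    (hE : ∀ p ∈ E, p.1 ≠ p.2) (w : Fin n × Fin n → ℝ) {ψ : (Fin n → Fin 2) → ℂ}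
    (hψ : ∑ f, Complex.normSq (ψ f) = 1) :
    (lasserre1Obj E w (momentMatrix ψ) : ℂ) =
      star ψ ⬝ᵥ (∑ p ∈ E, (w p : ℂ) •
        ((1 : Matrix (Fin n → Fin 2) (Fin n → Fin 2) ℂ) - twoLocal pauliX p.1 p.2
          - twoLocal pauliY p.1 p.2 - twoLocal pauliZ p.1 p.2)) *ᵥ ψ := by
  rw [lasserre1Obj, Matrix.sum_mulVec, dotProduct_sum]
  push_cast
  refine Finset.sum_congr rfl fun p hp => ?_
  simp only [momentMatrix_eq_twoLocal ψ _ (hE p hp), Matrix.smul_mulVec, Matrix.sub_mulVec,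
    Matrix.one_mulVec, dotProduct_smul, dotProduct_sub, star_dotProduct_self_eq_one hψ,
    smul_eq_mul]
  rfl

lemma Lasserre1Feasible.neg_one_le {n : ℕ} {M : Matrix (L1Idx n) (L1Idx n) ℝ}
    (hM : Lasserre1Feasible M) (a b : L1Idx n) : -1 ≤ M a b := by
  obtain ⟨hsymm, hpos, hdiag, -⟩ := hM
  have h := hpos.dotProduct_mulVec_nonneg (Pi.single a 1 + Pi.single b 1)
  have hba : M b a = M a b := hsymm.apply a b
  simp [Matrix.mulVec_add, hdiag, hba, add_dotProduct, dotProduct_add] at h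
  linarith

lemma Lasserre1Feasible.lasserre1Obj_le {n : ℕ} {E : Finset (Fin n × Fin n)}
    {w : Fin n × Fin n → ℝ} (hw : ∀ p ∈ E, 0 ≤ w p) {M : Matrix (L1Idx n) (L1Idx n) ℝ}
    (hM : Lasserre1Feasible M) : lasserre1Obj E w M ≤ ∑ p ∈ E, w p * 4 := by
  refine Finset.sum_le_sum fun p hp => mul_le_mul_of_nonneg_left ?_ (hw p hp)
  linarith [hM.neg_one_le (.inl (0, p.1)) (.inl (0, p.2)),
    hM.neg_one_le (.inl (1, p.1)) (.inl (1, p.2)),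
    hM.neg_one_le (.inl (2, p.1)) (.inl (2, p.2))]

/-- Lasserre₁ is a relaxation of Quantum Max Cut: for the Hamiltonian
`H = Σ_{ij∈E} w_ij (I − X_iX_j − Y_iY_j − Z_iZ_j)` of a graph on `n` vertices with
weights `w_e ≥ 0`, every unit vector `ψ ∈ ℂ^{2^n}` gives rise to a Lasserre₁-feasible
matrix whose objective equals `⟨ψ, Hψ⟩`; consequently every eigenvalue of `H` (in
particular, the largest) is at most the supremum of the Lasserre₁ objective over all
Lasserre₁-feasible matrices. -/
theorem lasserre1_relaxation {n : ℕ} (E : Finset (Fin n × Fin n))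
    (hE : ∀ p ∈ E, p.1 ≠ p.2) (w : Fin n × Fin n → ℝ) (hw : ∀ p ∈ E, 0 ≤ w p)
    (H : Matrix (Fin n → Fin 2) (Fin n → Fin 2) ℂ)
    (hH : H = ∑ p ∈ E, (w p : ℂ) •
      ((1 : Matrix (Fin n → Fin 2) (Fin n → Fin 2) ℂ)
        - twoLocal pauliX p.1 p.2 - twoLocal pauliY p.1 p.2 - twoLocal pauliZ p.1 p.2)) :
    (∀ ψ : (Fin n → Fin 2) → ℂ, ∑ f, Complex.normSq (ψ f) = 1 →
      ∃ M : Matrix (L1Idx n) (L1Idx n) ℝ, Lasserre1Feasible M ∧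
        (lasserre1Obj E w M : ℂ) = star ψ ⬝ᵥ H.mulVec ψ) ∧
    (∀ (hHerm : H.IsHermitian) (v : Fin n → Fin 2),
      hHerm.eigenvalues v ≤
        sSup {r : ℝ | ∃ M : Matrix (L1Idx n) (L1Idx n) ℝ,
          Lasserre1Feasible M ∧ lasserre1Obj E w M = r}) := by
  subst hH
  have hstate : ∀ ψ : (Fin n → Fin 2) → ℂ, ∑ f, Complex.normSq (ψ f) = 1 →
      Lasserre1Feasible (momentMatrix ψ) ∧ _ := fun ψ hψ =>
    ⟨momentMatrix_feasible hψ, lasserre1Obj_momentMatrix E hE w hψ⟩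
  refine ⟨fun ψ hψ => ⟨momentMatrix ψ, hstate ψ hψ⟩, fun hHerm v => ?_⟩
  have hunit : ∑ f, Complex.normSq (hHerm.eigenvectorBasis v f) = 1 := by
    simp only [Complex.normSq_eq_norm_sq, ← EuclideanSpace.norm_sq_eq,
      hHerm.eigenvectorBasis.orthonormal.1 v, one_pow]
  obtain ⟨hfeas, hobj⟩ := hstate _ hunit
  refine le_csSup ⟨_, fun r ⟨M, hM, hr⟩ => hr ▸ hM.lasserre1Obj_le hw⟩ ⟨_, hfeas, ?_⟩
  rw [hHerm.mulVec_eigenvectorBasis, dotProduct_smul, star_dotProduct_self_eq_one hunit] at hobj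
  simpa using congrArg Complex.re hobj
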